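/- arXiv:2311.04333 — 2 statements merged into one kernel-verified Lean document; each statement's English description precedes it below -/
import Mathlib

section
/- Let G be a finite simple graph with at least one edge, and let k_max be the largest k ∈ ℕ such that the k-core of G is nonempty. Then ρ* ≥ k_max/2, and every densest subgraph S* of G is contained in the ⌈k_max/2⌉-core of G. -/
open Finset
open scoped Classical

variable {V : Type*}

/-- `degS G S v` is the degree of `v` in the subgraph of `G` induced by the vertex set `S`. -/
noncomputable def degS [Fintype V] (G : SimpleGraph V) (S : Finset V) (v : V) : ℕ :=
  (S.filter fun u => G.Adj v u).card

/-- `edgeCount G S` is the number of edges of the subgraph of `G` induced by `S`. -/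
noncomputable def edgeCount [Fintype V] (G : SimpleGraph V) (S : Finset V) : ℕ :=
  (G.edgeFinset.filter fun ed => ∀ v ∈ ed, v ∈ S).card

/-- `density G S` is the density `|E(G[S])| / |S|` of the induced subgraph `G[S]`, as a rational. -/
noncomputable def density [Fintype V] (G : SimpleGraph V) (S : Finset V) : ℚ :=
  (edgeCount G S : ℚ) / (S.card : ℚ)

theorem edgeCount_insert_aux [Fintype V] (G : SimpleGraph V) (S : Finset V) (v : V) (hv : v ∉ S) :
    edgeCount G (insert v S) = edgeCount G S + degS G S v := by
  unfold edgeCount degS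
  have hinj : Function.Injective (fun u : V => s(v, u)) := by
    intro a b h
    exact Sym2.congr_right.1 h
  rw [← Finset.card_image_of_injective (S.filter fun u => G.Adj v u) hinj,
    ← Finset.card_union_of_disjoint]
  · congr 1
    ext e
    induction e using Sym2.ind with
    | _ a b =>
      simp only [Finset.mem_filter, Finset.mem_union, Finset.mem_image, SimpleGraph.mem_edgeFinset,
        SimpleGraph.mem_edgeSet, Sym2.mem_iff, Finset.mem_insert, forall_eq_or_imp, forall_eq,
        Sym2.eq_iff]
      constructor
      · rintro ⟨hab, ha, hb⟩
        rcases ha with rfl | ha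
        · rcases hb with rfl | hb
          · exact absurd hab (G.loopless.irrefl _)
          · exact Or.inr ⟨b, ⟨hb, hab⟩, Or.inl ⟨rfl, rfl⟩⟩
        · rcases hb with rfl | hb
          · exact Or.inr ⟨a, ⟨ha, hab.symm⟩, Or.inr ⟨rfl, rfl⟩⟩
          · exact Or.inl ⟨hab, ha, hb⟩
      · rintro (⟨hab, ha, hb⟩ | ⟨u, ⟨hu, huv⟩, ⟨rfl, rfl⟩ | ⟨rfl, rfl⟩⟩)
        · exact ⟨hab, Or.inr ha, Or.inr hb⟩
        · exact ⟨huv, Or.inl rfl, Or.inr hu⟩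
        · exact ⟨huv.symm, Or.inr hu, Or.inl rfl⟩
  · rw [Finset.disjoint_left]
    intro e he he'
    obtain ⟨u, -, rfl⟩ := Finset.mem_image.1 he'
    exact hv ((Finset.mem_filter.1 he).2 v (by simp))

theorem degS_insert_aux [Fintype V] (G : SimpleGraph V) (S : Finset V) (v u : V) (hv : v ∉ S) :
    degS G (insert v S) u = degS G S u + if G.Adj v u then 1 else 0 := by
  unfold degS
  rw [Finset.filter_insert]
  by_cases h : G.Adj v u
  · rw [if_pos h.symm, if_pos h, Finset.card_insert_of_notMem (by simp [hv])]
  · rw [if_neg (fun h' => h h'.symm), if_neg h, add_zero]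

theorem handshake_aux [Fintype V] (G : SimpleGraph V) (S : Finset V) :
    ∑ u ∈ S, degS G S u = 2 * edgeCount G S := by
  induction S using Finset.induction_on with
  | empty =>
    have h : edgeCount G ∅ = 0 := by
      unfold edgeCount
      rw [Finset.card_eq_zero, Finset.filter_eq_empty_iff]
      intro e _ h
      induction e using Sym2.ind with
      | _ a b => exact absurd (h a (by simp)) (by simp)
    simp [h]
  | insert v S hv ih =>
    rw [Finset.sum_insert hv, edgeCount_insert_aux G S v hv, degS_insert_aux G S v v hv,
      Finset.sum_congr rfl (fun u _ => degS_insert_aux G S v u hv), Finset.sum_add_distrib, ih,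
      if_neg (G.loopless.irrefl v), ← Finset.card_filter]
    change _ + 0 + (_ + degS G S v) = _
    ring

theorem degS_mono_aux [Fintype V] (G : SimpleGraph V) {S T : Finset V} (h : S ⊆ T) (v : V) :
    degS G S v ≤ degS G T v :=
  Finset.card_le_card (Finset.filter_subset_filter _ h)

/-- If `kmax` is the largest `k` with nonempty `k`-core, then `ρ* ≥ kmax/2`, and every
densest subgraph is contained in the `⌈kmax/2⌉`-core. -/
theorem density_ge_half_kmax_and_subset_core
    [Fintype V] (G : SimpleGraph V) (hE : ∃ u v : V, G.Adj u v)
    (kmax : ℕ)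
    (hk1 : ∃ C : Finset V, C.Nonempty ∧ ∀ v ∈ C, kmax ≤ degS G C v)
    (hk2 : ∀ k : ℕ, (∃ C : Finset V, C.Nonempty ∧ ∀ v ∈ C, k ≤ degS G C v) → k ≤ kmax)
    (Sstar : Finset V) (hne : Sstar.Nonempty)
    (hmax : ∀ S : Finset V, S.Nonempty → density G S ≤ density G Sstar)
    (C : Finset V) (hC : ∀ v ∈ C, ⌈(kmax : ℚ) / 2⌉₊ ≤ degS G C v)
    (hCmax : ∀ T : Finset V, (∀ v ∈ T, ⌈(kmax : ℚ) / 2⌉₊ ≤ degS G T v) → C ⊆ T → T = C) :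
    (kmax : ℚ) / 2 ≤ density G Sstar ∧ Sstar ⊆ C := by
  have h1 : (kmax : ℚ) / 2 ≤ density G Sstar := by
    obtain ⟨K, hK, hdeg⟩ := hk1
    refine le_trans ?_ (hmax K hK)
    have hpos : (0 : ℚ) < K.card := by exact_mod_cast hK.card_pos
    have hsum : K.card * kmax ≤ 2 * edgeCount G K := by
      rw [← handshake_aux, ← smul_eq_mul]
      exact Finset.card_nsmul_le_sum K _ kmax hdeg
    have hq : (K.card : ℚ) * kmax ≤ 2 * edgeCount G K := by exact_mod_cast hsum
    unfold density
    rw [le_div_iff₀ hpos]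
    linarith
  refine ⟨h1, ?_⟩
  have hle : ∀ T : Finset V, (edgeCount G T : ℚ) ≤ density G Sstar * T.card := by
    intro T
    rcases T.eq_empty_or_nonempty with rfl | hT
    · have := handshake_aux G ∅
      simp at this
      simp [this]
    · have hpos : (0 : ℚ) < T.card := by exact_mod_cast hT.card_pos
      rw [← div_le_iff₀ hpos]
      exact hmax T hT
  have hdeg : ∀ v ∈ Sstar, ⌈(kmax : ℚ) / 2⌉₊ ≤ degS G Sstar v := by
    intro v hv
    rw [Nat.ceil_le]
    refine le_trans h1 ?_
    have hv' : v ∉ Sstar.erase v := Finset.notMem_erase v _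
    have he := edgeCount_insert_aux G (Sstar.erase v) v hv'
    rw [Finset.insert_erase hv] at he
    have hm : (degS G (Sstar.erase v) v : ℚ) ≤ degS G Sstar v := by
      exact_mod_cast degS_mono_aux G (Finset.erase_subset v Sstar) v
    have hc := Finset.card_erase_add_one hv
    have hpos : (0 : ℚ) < Sstar.card := by exact_mod_cast hne.card_pos
    have hS : density G Sstar * Sstar.card = edgeCount G Sstar := by
      unfold density
      exact div_mul_cancel₀ _ hpos.ne'
    have hl := hle (Sstar.erase v)
    have he' : (edgeCount G Sstar : ℚ)
        = edgeCount G (Sstar.erase v) + degS G (Sstar.erase v) v := by exact_mod_cast he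
    have hc' : ((Sstar.erase v).card : ℚ) + 1 = Sstar.card := by exact_mod_cast hc
    rw [← hc'] at hS
    linarith
  have hT := hCmax (C ∪ Sstar) (by
    intro v hv
    rcases Finset.mem_union.1 hv with h | h
    · exact (hC v h).trans (degS_mono_aux G Finset.subset_union_left v)
    · exact (hdeg v h).trans (degS_mono_aux G Finset.subset_union_right v))
    Finset.subset_union_left
  rw [← hT]
  exact Finset.subset_union_right
end

section
/- Let G be a finite simple graph with at least one edge, and let k_max be the largest k ∈ ℕ such that the k-core of G is nonempty. Then ⌈ρ*⌉ ≤ k_max; in particular ρ* ≤ k_max, so together with ρ* ≥ k_max/2 the maximum core number k_max is within a factor of 2 of the maximum subgraph density ρ*. -/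
open Finset
open scoped Classical

variable {V : Type*}

lemma edgeCount_le_erase [Fintype V] (G : SimpleGraph V) (S : Finset V) (v : V) :
    edgeCount G S ≤ edgeCount G (S.erase v) + degS G S v := by
  unfold edgeCount degS
  have hsub : (G.edgeFinset.filter fun ed => ∀ w ∈ ed, w ∈ S) ⊆
      (G.edgeFinset.filter fun ed => ∀ w ∈ ed, w ∈ S.erase v) ∪
        (S.filter fun u => G.Adj v u).image (fun u => s(v, u)) := by
    intro ed hed
    rw [Finset.mem_filter, SimpleGraph.mem_edgeFinset] at hed
    obtain ⟨h1, h2⟩ := hed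
    rw [Finset.mem_union]
    by_cases hv : v ∈ ed
    · right
      obtain ⟨u, rfl⟩ := Sym2.mem_iff_exists.mp hv
      rw [Finset.mem_image]
      refine ⟨u, ?_, rfl⟩
      rw [Finset.mem_filter]
      exact ⟨h2 u (Sym2.mem_mk_right v u), h1⟩
    · left
      rw [Finset.mem_filter, SimpleGraph.mem_edgeFinset]
      refine ⟨h1, fun w hw => Finset.mem_erase.mpr ⟨?_, h2 w hw⟩⟩
      rintro rfl
      exact hv hw
  refine (Finset.card_le_card hsub).trans ((Finset.card_union_le _ _).trans ?_)
  exact Nat.add_le_add_left Finset.card_image_le _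

lemma edgeCount_le_mul [Fintype V] (G : SimpleGraph V) (kmax : ℕ)
    (hk2 : ∀ k : ℕ, (∃ C : Finset V, C.Nonempty ∧ ∀ v ∈ C, k ≤ degS G C v) → k ≤ kmax)
    (n : ℕ) : ∀ S : Finset V, S.card = n → edgeCount G S ≤ kmax * n := by
  induction n with
  | zero =>
    intro S hS
    rw [Finset.card_eq_zero] at hS
    subst hS
    simp only [edgeCount, mul_zero, Nat.le_zero, Finset.card_eq_zero]
    refine Finset.filter_eq_empty_iff.mpr fun ed _ h => ?_
    induction ed with
    | h a b => exact Finset.notMem_empty _ (h a (Sym2.mem_mk_left a b))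
  | succ n ih =>
    intro S hS
    have hne : S.Nonempty := Finset.card_pos.mp (by omega)
    obtain ⟨v, hv, hd⟩ : ∃ v ∈ S, degS G S v ≤ kmax := by
      by_contra hcon
      push Not at hcon
      have := hk2 (kmax + 1) ⟨S, hne, fun v hv => hcon v hv⟩
      omega
    have h1 := edgeCount_le_erase G S v
    have h2 := ih (S.erase v) (by rw [Finset.card_erase_of_mem hv]; omega)
    rw [mul_add, mul_one]
    omega

/-- If `kmax` is the largest `k` with nonempty `k`-core, then `⌈ρ*⌉ ≤ kmax`; in
particular `ρ* ≤ kmax`. -/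
theorem ceil_density_le_kmax
    [Fintype V] (G : SimpleGraph V) (hE : ∃ u v : V, G.Adj u v)
    (kmax : ℕ)
    (hk1 : ∃ C : Finset V, C.Nonempty ∧ ∀ v ∈ C, kmax ≤ degS G C v)
    (hk2 : ∀ k : ℕ, (∃ C : Finset V, C.Nonempty ∧ ∀ v ∈ C, k ≤ degS G C v) → k ≤ kmax)
    (Sstar : Finset V) (hne : Sstar.Nonempty)
    (hmax : ∀ S : Finset V, S.Nonempty → density G S ≤ density G Sstar) :
    ⌈density G Sstar⌉ ≤ (kmax : ℤ) ∧ density G Sstar ≤ (kmax : ℚ) := by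
  have h : density G Sstar ≤ (kmax : ℚ) := by
    have hpos : (0 : ℚ) < (Sstar.card : ℚ) := by exact_mod_cast hne.card_pos
    unfold density
    rw [div_le_iff₀ hpos]
    exact_mod_cast edgeCount_le_mul G kmax hk2 _ Sstar rfl
  exact ⟨Int.ceil_le.mpr (by exact_mod_cast h), h⟩
end
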